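/- The class of all finite structures (X, ≺, <, T), where ≺ is a strict partial order, < is a strict linear order extending ≺ (x ≺ y implies x < y), and T is a tournament relation (for all distinct x, y exactly one of T(x,y), T(y,x) holds, and never T(x,x)), has the Ramsey property: for all A, B in this class and all r ∈ ℕ there exists C in this class such that for every coloring χ : Emb(A,C) → Fin r there is g ∈ Emb(B,C) with χ constant on {g ∘ f : f ∈ Emb(A,B)}. -/

import Mathlib

/-- A relational structure with binary relations indexed by `ι`. -/
structure BinStr (ι : Type) : Type 1 where
  carrier : Type
  rel : ι → carrier → carrier → Prop

/-- An embedding of such structures: an injective map that preserves and reflects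
each of the relations. -/
structure BinEmb {ι : Type} (A B : BinStr ι) : Type where
  toFun : A.carrier → B.carrier
  inj : Function.Injective toFun
  map_rel : ∀ (i : ι) (x y : A.carrier), A.rel i x y ↔ B.rel i (toFun x) (toFun y)

/-- Composition of embeddings. -/
def BinEmb.comp {ι : Type} {A B C : BinStr ι} (g : BinEmb B C) (f : BinEmb A B) :
    BinEmb A C where
  toFun := g.toFun ∘ f.toFun
  inj := g.inj.comp f.inj
  map_rel i x y := (f.map_rel i x y).trans (g.map_rel i (f.toFun x) (f.toFun y))

/-- The Ramsey property for a class of structures: for all `A, B` in the class and all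
`r : ℕ` there is `C` in the class such that every colouring of the embeddings of `A` into `C`
with `r` colours is constant on the copies of `A` inside some copy of `B` in `C`. -/
def BinRamseyClass {ι : Type} (K : Set (BinStr ι)) : Prop :=
  ∀ A ∈ K, ∀ B ∈ K, ∀ r : ℕ, ∃ C ∈ K,
    ∀ χ : BinEmb A C → Fin r, ∃ g : BinEmb B C,
      ∀ f₁ f₂ : BinEmb A B, χ (g.comp f₁) = χ (g.comp f₂)

/-- `ParamWord a k l` says that `l` is a parameter word over the alphabet `{0, …, a - 1}` with
parameters `a, …, a + k - 1`, all of which occur, in increasing order of first occurrence. -/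
inductive ParamWord : ℕ → ℕ → List ℕ → Prop
  | nil (a : ℕ) : ParamWord a 0 []
  | letter {a k x : ℕ} {l : List ℕ} : x < a → ParamWord a k l → ParamWord a k (x :: l)
  | param {a k : ℕ} {l : List ℕ} : ParamWord (a + 1) k l → ParamWord a (k + 1) (a :: l)

/-- The letter map fixing the letters below `a` and sending the parameter `a + j` to the `j`-th
entry of `s`. -/
def letterSubst (a : ℕ) (s : List ℕ) (i : ℕ) : ℕ :=
  if i < a then i else s.getD (i - a) 0

/-- The letter map which makes room for a new letter `a`. -/
def letterShift (a i : ℕ) : ℕ := if i < a then i else i + 1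

theorem letterSubst_of_lt {a i : ℕ} (s : List ℕ) (h : i < a) : letterSubst a s i = i :=
  if_pos h

theorem letterSubst_cons_self (a y : ℕ) (s : List ℕ) : letterSubst a (y :: s) a = y := by
  simp [letterSubst]

theorem letterSubst_cons_same (a : ℕ) (s : List ℕ) :
    letterSubst a (a :: s) = letterSubst (a + 1) s := by
  funext i
  rcases lt_trichotomy i a with h | rfl | h
  · simp [letterSubst, h, h.trans (Nat.lt_succ_self a)]
  · simp [letterSubst]
  · obtain ⟨j, rfl⟩ := Nat.exists_eq_add_of_lt h
    have : a + j + 1 - a = j + 1 := by omega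
    simp [letterSubst, this, show ¬ a + j + 1 < a by omega, show a + j - a = j by omega]

theorem letterSubst_cons_letterShift (a y : ℕ) (s : List ℕ) (i : ℕ) :
    letterSubst a (y :: s) (letterShift a i) = letterSubst a s i := by
  by_cases h : i < a
  · simp [letterSubst, letterShift, h]
  · have : i + 1 - a = (i - a) + 1 := by omega
    simp [letterSubst, letterShift, h, this, show ¬ i + 1 < a by omega]

theorem letterSubst_letterSubst {a : ℕ} (ha : 0 < a) (s t : List ℕ) (i : ℕ) :
    letterSubst a t (letterSubst a s i) = letterSubst a (s.map (letterSubst a t)) i := by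
  by_cases h : i < a
  · simp [letterSubst, h]
  · have h0 : letterSubst a t 0 = 0 := letterSubst_of_lt t ha
    have hs : ∀ s : List ℕ, letterSubst a s i = s.getD (i - a) 0 := fun s => if_neg h
    rw [hs, hs]
    conv_rhs => rw [← h0, List.getD_map]

theorem map_letterSubst_map {a : ℕ} (ha : 0 < a) (f s t : List ℕ) :
    (f.map (letterSubst a s)).map (letterSubst a t) =
      f.map (letterSubst a (s.map (letterSubst a t))) := by
  simp [letterSubst_letterSubst ha]

theorem map_letterSubst_range' (a : ℕ) (s : List ℕ) :
    (List.range' a s.length).map (letterSubst a s) = s := by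
  apply List.ext_getElem
  · simp
  · intro i h₁ h₂
    simp [letterSubst, h₂]

namespace ParamWord

theorem range' (a m : ℕ) : ParamWord a m (List.range' a m) := by
  induction m generalizing a with
  | zero => exact nil a
  | succ m ih => exact param (ih (a + 1))

theorem map {b m : ℕ} {f : List ℕ} (hf : ParamWord b m f) {a k : ℕ} {φ : ℕ → ℕ}
    (hφ : ∀ i < b, φ i < a) (hg : ParamWord a k ((List.range' b m).map φ)) :
    ParamWord a k (f.map φ) := by
  induction hf generalizing a k with
  | nil b => exact hg
  | letter hx _ ih => exact letter (hφ _ hx) (ih hφ hg)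
  | @param b m l _ ih =>
    rw [List.range'_succ, List.map_cons] at hg
    rw [List.map_cons]
    generalize hy : φ b = y at hg ⊢
    cases hg with
    | letter hya hg =>
      refine letter hya (ih (fun i hi => ?_) hg)
      rcases Nat.lt_succ_iff_lt_or_eq.1 hi with h | rfl
      · exact hφ i h
      · omega
    | param hg =>
      refine param (ih (fun i hi => ?_) hg)
      rcases Nat.lt_succ_iff_lt_or_eq.1 hi with h | rfl
      · exact (hφ i h).trans (Nat.lt_succ_self _)
      · omega

theorem subst {a m k : ℕ} {f g : List ℕ} (hf : ParamWord a m f) (hg : ParamWord a k g)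
    (hm : g.length = m) : ParamWord a k (f.map (letterSubst a g)) := by
  subst hm
  refine hf.map (fun i hi => by rwa [letterSubst_of_lt g hi]) ?_
  rwa [map_letterSubst_range']

theorem shift {a m : ℕ} {f : List ℕ} (hf : ParamWord a m f) :
    ParamWord (a + 1) m (f.map (letterShift a)) := by
  refine hf.map (fun i hi => ?_) ?_
  · simp only [letterShift, if_pos hi]; omega
  · convert range' (a + 1) m using 1
    apply List.ext_getElem
    · simp
    · intro i h₁ h₂
      simp [letterShift]
      omega

theorem append {a k m : ℕ} {f e : List ℕ} (hf : ParamWord a k f)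
    (he : ParamWord (a + k) m e) : ParamWord a (k + m) (f ++ e) := by
  induction hf with
  | nil a => simpa using he
  | letter hx _ ih => exact letter hx (ih he)
  | @param a k l _ ih =>
    rw [Nat.add_right_comm]
    exact param (ih (by rwa [Nat.add_right_comm, Nat.add_assoc]))

theorem lt {a k : ℕ} {l : List ℕ} (h : ParamWord a k l) {x : ℕ} (hx : x ∈ l) : x < a + k := by
  induction h with
  | nil => simp at hx
  | letter hy _ ih =>
    rcases List.mem_cons.1 hx with rfl | hx
    · omega
    · exact ih hx
  | param _ ih =>
    rcases List.mem_cons.1 hx with rfl | hx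
    · omega
    · have := ih hx
      omega

theorem exists_first {a k : ℕ} {l : List ℕ} (h : ParamWord a k l) {y : ℕ} (hay : a ≤ y)
    (hy : y < a + k) : ∃ l₁ l₂, l = l₁ ++ y :: l₂ ∧ ∀ z ∈ l₁, z < y := by
  induction h with
  | nil => omega
  | @letter a k x l hx _ ih =>
    obtain ⟨l₁, l₂, rfl, hl⟩ := ih hay hy
    refine ⟨x :: l₁, l₂, rfl, fun z hz => ?_⟩
    rcases List.mem_cons.1 hz with rfl | hz
    · omega
    · exact hl z hz
  | @param a k l _ ih =>
    rcases hay.eq_or_lt with rfl | hlt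
    · exact ⟨[], l, rfl, by simp⟩
    · obtain ⟨l₁, l₂, rfl, hl⟩ := ih hlt (by omega)
      refine ⟨a :: l₁, l₂, rfl, fun z hz => ?_⟩
      rcases List.mem_cons.1 hz with rfl | hz
      · omega
      · exact hl z hz

theorem of_exists_first {a k : ℕ} {l : List ℕ} (hlt : ∀ x ∈ l, x < a + k)
    (h : ∀ y, a ≤ y → y < a + k → ∃ l₁ l₂, l = l₁ ++ y :: l₂ ∧ ∀ z ∈ l₁, z < y) :
    ParamWord a k l := by
  induction l generalizing a k with
  | nil =>
    cases k with
    | zero => exact nil a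
    | succ k =>
      obtain ⟨l₁, l₂, h, -⟩ := h a le_rfl (by omega)
      simp at h
  | cons x l ih =>
    by_cases hx : x < a
    · refine letter hx (ih (fun z hz => hlt z (List.mem_cons_of_mem _ hz)) fun y hy hyk => ?_)
      obtain ⟨l₁, l₂, he, hl⟩ := h y hy hyk
      cases l₁ with
      | nil => simp at he; omega
      | cons z l₁ =>
        simp only [List.cons_append, List.cons.injEq] at he
        exact ⟨l₁, l₂, he.2, fun w hw => hl w (List.mem_cons_of_mem _ hw)⟩
    · have hxk := hlt x List.mem_cons_self
      obtain ⟨k, rfl⟩ : ∃ k', k = k' + 1 := ⟨k - 1, by omega⟩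
      obtain rfl : x = a := by
        obtain ⟨l₁, l₂, he, hl⟩ := h a le_rfl (by omega)
        cases l₁ with
        | nil => simp at he; exact he.1
        | cons z l₁ =>
          simp only [List.cons_append, List.cons.injEq] at he
          have := hl z List.mem_cons_self
          omega
      refine param (ih (fun z hz => ?_) fun y hy hyk => ?_)
      · have := hlt z (List.mem_cons_of_mem _ hz)
        omega
      · obtain ⟨l₁, l₂, he, hl⟩ := h y (by omega) (by omega)
        cases l₁ with
        | nil => simp at he; omega
        | cons z l₁ =>
          simp only [List.cons_append, List.cons.injEq] at he
          exact ⟨l₁, l₂, he.2, fun w hw => hl w (List.mem_cons_of_mem _ hw)⟩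

end ParamWord

/-- The Hales–Jewett theorem in terms of parameter words with one parameter. -/
theorem exists_line (a : ℕ) (κ : Type) [Finite κ] :
    ∃ n, ∀ χ : List ℕ → κ, ∃ f : List ℕ, ParamWord a 1 f ∧ f.length = n ∧
      ∀ x < a, ∀ y < a,
        χ (f.map (letterSubst a [x])) = χ (f.map (letterSubst a [y])) := by
  obtain ⟨n, hn⟩ :=
    Combinatorics.Subspace.exists_mono_in_high_dimension_fin (Fin a) κ Unit
  refine ⟨n, fun χ => ?_⟩
  obtain ⟨l, c, hc⟩ := hn fun v => χ (List.ofFn fun i => (v i : ℕ))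
  set f : List ℕ := List.ofFn fun i => (l.idxFun i).elim (fun j : Fin a => (j : ℕ)) fun _ => a with hf
  have hmap : ∀ x < a, χ (f.map (letterSubst a [x])) = c := by
    intro x hx
    rw [← hc fun _ => ⟨x, hx⟩, hf, List.map_ofFn]
    congr 2
    funext i
    simp only [Function.comp, Combinatorics.Subspace.apply_def]
    cases l.idxFun i with
    | inl j => simp [letterSubst]
    | inr _ => simp [letterSubst]
  refine ⟨f, ?_, by simp [hf], fun x hx y hy => by rw [hmap x hx, hmap y hy]⟩
  have hle : ∀ x ∈ f, x ≤ a := by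
    intro x hx
    obtain ⟨i, rfl⟩ := List.mem_ofFn.1 hx
    cases l.idxFun i with
    | inl j => exact j.2.le
    | inr _ => exact le_rfl
  refine ParamWord.of_exists_first (fun x hx => Nat.lt_succ_of_le (hle x hx)) fun y hy hy' => ?_
  obtain rfl : y = a := by omega
  have hmem : y ∈ f := by
    obtain ⟨i, hi⟩ := l.proper ()
    exact List.mem_ofFn.2 ⟨i, by simp [hi]⟩
  obtain ⟨l₁, l₂, he, hl⟩ := List.eq_append_cons_of_mem hmem
  refine ⟨l₁, l₂, he, fun z hz => lt_of_le_of_ne (hle z (by simp [he, hz])) ?_⟩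
  rintro rfl
  exact hl hz

/-- Stabilising the colour of the part of a word preceding the first parameter. -/
theorem exists_forall_takeWhile_eq {a : ℕ} (ha : 0 < a) (M : ℕ) (κ : Type) [Finite κ] :
    ∃ n, ∀ χ : List ℕ → κ, ∃ f : List ℕ, ParamWord a M f ∧ f.length = n ∧ ∃ d : ℕ → κ,
      ∀ g : List ℕ, g.length = M →
        χ ((f.map (letterSubst a g)).takeWhile (· < a)) =
          d (g.takeWhile (· < a)).length := by
  induction M with
  | zero =>
    refine ⟨0, fun χ => ⟨[], .nil a, rfl, fun _ => χ [], fun g hg => by simp⟩⟩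
  | succ M ih =>
    obtain ⟨N, hN⟩ := ih
    have : Finite {l : List (Fin a) // l.length ≤ N} := List.finite_length_le (Fin a) N
    obtain ⟨n₁, hn₁⟩ := exists_line a ({l : List (Fin a) // l.length ≤ N} → κ)
    refine ⟨n₁ + N, fun χ => ?_⟩
    obtain ⟨f₁, hf₁, hlen₁, hline⟩ := hn₁ fun u w => χ (u ++ w.1.map (↑))
    obtain ⟨e, he, hlen, d, hd⟩ := hN fun w => χ (f₁.map (letterSubst a [0]) ++ w)
    refine ⟨f₁ ++ e.map (letterShift a), ?_, by simp [hlen₁, hlen], fun j =>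
      j.casesOn (χ (f₁.takeWhile (· < a))) d, fun g hg => ?_⟩
    · rw [Nat.add_comm]
      exact hf₁.append he.shift
    obtain ⟨y, g, rfl⟩ : ∃ y g', g = y :: g' := by
      cases g with
      | nil => simp at hg
      | cons y g => exact ⟨y, g, rfl⟩
    have hg' : g.length = M := by simpa using hg
    have hshift : (e.map (letterShift a)).map (letterSubst a (y :: g)) =
        e.map (letterSubst a g) := by
      simp [letterSubst_cons_letterShift]
    have hf₁y : f₁.map (letterSubst a (y :: g)) = f₁.map (letterSubst a [y]) := by
      refine List.map_congr_left fun i hi => ?_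
      have := hf₁.lt hi
      rcases (Nat.lt_succ_iff_lt_or_eq.1 this) with h | rfl
      · rw [letterSubst_of_lt _ h, letterSubst_of_lt _ h]
      · rw [letterSubst_cons_self, letterSubst_cons_self]
    rw [List.map_append, hshift, hf₁y]
    by_cases hy : y < a
    · have hall : ∀ x < a, ∀ i ∈ f₁.map (letterSubst a [x]), i < a := by
        intro x hx i hi
        obtain ⟨j, hj, rfl⟩ := List.mem_map.1 hi
        rcases (Nat.lt_succ_iff_lt_or_eq.1 (hf₁.lt hj)) with h | rfl
        · rwa [letterSubst_of_lt _ h]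
        · rwa [letterSubst_cons_self]
      rw [List.takeWhile_append_of_pos (by simpa using hall y hy),
        List.takeWhile_cons_of_pos (by simpa using hy)]
      simp only [List.length_cons]
      rw [← hd g hg']
      set w := (e.map (letterSubst a g)).takeWhile (· < a) with hw
      have hwa : ∀ i ∈ w, i < a := fun i hi => by
        simpa using List.mem_takeWhile_imp hi
      obtain ⟨w', hw'⟩ : ∃ w' : List (Fin a), w'.map (↑) = w :=
        ⟨w.attach.map fun i => ⟨i.1, hwa i.1 i.2⟩, by simp [Function.comp_def]⟩
      have hwlen : w'.length ≤ N := by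
        rw [← List.length_map (f := ((↑) : Fin a → ℕ)), hw', ← hlen,
          ← List.length_map (as := e) (f := letterSubst a g)]
        exact (List.takeWhile_sublist _).length_le
      have := congrFun (hline y hy 0 ha) ⟨w', hwlen⟩
      simpa only [hw'] using this
    · rw [List.takeWhile_cons_of_neg (by simpa using hy)]
      obtain ⟨l₁, l₂, rfl, hl⟩ := hf₁.exists_first le_rfl (Nat.lt_succ_self a)
      have hl' : l₁.map (letterSubst a [y]) = l₁ :=
        (List.map_congr_left fun i hi => letterSubst_of_lt _ (hl i hi)).trans (List.map_id _)
      simp only [List.map_append, List.map_cons, hl', letterSubst_cons_self, List.append_assoc,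
        List.cons_append]
      rw [List.takeWhile_append_of_pos (by simpa using hl),
        List.takeWhile_append_of_pos (by simpa using hl),
        List.takeWhile_cons_of_neg (by simpa using hy), List.takeWhile_cons_of_neg (by simp)]
      rfl

/-- A parameter word through which the first parameter always lands in a prescribed set. -/
theorem exists_takeWhile_length_mem {a : ℕ} (ha : 0 < a) (J : ℕ → Prop) [DecidablePred J]
    (M : ℕ) : ∃ f : List ℕ, ParamWord a (Nat.count J M) f ∧ f.length = M ∧
      ∀ g : List ℕ, g.length = Nat.count J M → (∃ x ∈ g, a ≤ x) →
        J ((f.map (letterSubst a g)).takeWhile (· < a)).length := by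
  induction M generalizing J with
  | zero => exact ⟨[], by simpa using .nil a, rfl, fun g hg ⟨x, hx, _⟩ => by
      have : g = [] := by simpa using hg
      simp [this] at hx⟩
  | succ M ih =>
    obtain ⟨f, hf, hlen, hJ⟩ := ih fun i => J (i + 1)
    rw [Nat.count_succ']
    by_cases h0 : J 0
    · simp only [h0, if_true]
      refine ⟨a :: f.map (letterShift a), .param hf.shift, by simp [hlen], ?_⟩
      rintro (_ | ⟨y, g⟩) hg ⟨x, hx, hax⟩
      · simp at hx
      simp only [List.map_cons, letterSubst_cons_self, List.map_map, Function.comp_def,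
        letterSubst_cons_letterShift]
      by_cases hy : y < a
      · rw [List.takeWhile_cons_of_pos (by simpa using hy)]
        refine hJ g (by simpa using hg) ⟨x, ?_, hax⟩
        rcases List.mem_cons.1 hx with rfl | hx
        · omega
        · exact hx
      · rwa [List.takeWhile_cons_of_neg (by simpa using hy)]
    · simp only [h0, if_false, Nat.add_zero]
      refine ⟨0 :: f, .letter ha hf, by simp [hlen], fun g hg hx => ?_⟩
      rw [List.map_cons, letterSubst_of_lt _ ha, List.takeWhile_cons_of_pos (by simpa using ha)]
      exact hJ g hg hx

/-- The conclusion of the Graham–Rothschild theorem for `k`-parameter words. -/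
def GrahamRothschild (k : ℕ) : Prop :=
  ∀ a, 0 < a → ∀ (m : ℕ) (κ : Type) [Finite κ], ∃ n, ∀ χ : List ℕ → κ,
    ∃ f : List ℕ, ParamWord a m f ∧ f.length = n ∧
      ∃ c, ∀ g, ParamWord a k g → g.length = m → χ (f.map (letterSubst a g)) = c

/-- Making the colour depend only on the part of a word preceding the first parameter. -/
theorem GrahamRothschild.exists_eq_takeWhile {k : ℕ} (hk : GrahamRothschild k) {a : ℕ}
    (ha : 0 < a) (M : ℕ) (κ : Type) [Finite κ] :
    ∃ n, ∀ χ : List ℕ → κ, ∃ f : List ℕ, ParamWord a M f ∧ f.length = n ∧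
      ∃ c : List ℕ → κ, ∀ g, ParamWord a (k + 1) g → g.length = M →
        χ (f.map (letterSubst a g)) = c (g.takeWhile (· < a)) := by
  induction M generalizing κ with
  | zero =>
    refine ⟨0, fun χ => ⟨[], .nil a, rfl, fun _ => χ [], fun g hg hlen => by simp⟩⟩
  | succ M ih =>
    obtain ⟨N, hN⟩ := ih (Fin a → κ)
    obtain ⟨N', hN'⟩ := hk (a + 1) (Nat.succ_pos a) N κ
    refine ⟨N' + 1, fun χ => ?_⟩
    obtain ⟨h, hh, hhlen, c₀, hc₀⟩ := hN' fun w => χ (a :: w)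
    obtain ⟨e, he, helen, c₁, hc₁⟩ :=
      hN fun w (y : Fin a) => χ (y :: h.map (letterSubst a (y :: w)))
    have hel : (e.map (letterShift a)).length = N := by simp [helen]
    refine ⟨a :: h.map (letterSubst (a + 1) (e.map (letterShift a))),
      .param (hh.subst he.shift hel), by simp [hhlen], fun u => u.casesOn c₀ fun y u' =>
        if hy : y < a then c₁ u' ⟨y, hy⟩ else c₀, ?_⟩
    rintro (_ | ⟨y, g⟩) hg hlen
    · simp at hlen
    have hlen' : g.length = M := by simpa using hlen
    rw [List.map_cons, letterSubst_cons_self]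
    cases hg with
    | letter hy hg =>
      rw [List.takeWhile_cons_of_pos (by simpa using hy)]
      have := congrFun (hc₁ g hg hlen') ⟨y, hy⟩
      simp only [hy, dif_pos]
      rw [← this, ← letterSubst_cons_same, map_letterSubst_map ha]
      simp [letterSubst_cons_self, letterSubst_cons_letterShift, Function.comp_def]
    | param hg =>
      rw [List.takeWhile_cons_of_neg (by simp), letterSubst_cons_same,
        map_letterSubst_map (Nat.succ_pos a)]
      exact hc₀ _ (he.shift.subst hg hlen') (by simp [helen])

/-- The **Graham–Rothschild theorem**. -/
theorem grahamRothschild (k : ℕ) : GrahamRothschild k := by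
  induction k with
  | zero =>
    intro a ha m κ _
    obtain ⟨n, hn⟩ := exists_forall_takeWhile_eq ha m κ
    refine ⟨n, fun χ => ?_⟩
    obtain ⟨f, hf, hlen, d, hd⟩ := hn χ
    refine ⟨f, hf, hlen, d m, fun g hg hgm => ?_⟩
    have htake : ∀ l, ParamWord a 0 l → l.takeWhile (· < a) = l := fun l hl =>
      List.takeWhile_eq_self_iff.2 fun x hx => by simpa using hl.lt hx
    have := hd g hgm
    rwa [htake _ hg, htake _ (hf.subst hg hgm), hgm] at this
  | succ k hk =>
    intro a ha m κ _
    classical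
    obtain ⟨M, hM⟩ : ∃ M, Nat.card κ * m < M := ⟨_, Nat.lt_succ_self _⟩
    obtain ⟨N₂, hN₂⟩ := exists_forall_takeWhile_eq ha M κ
    obtain ⟨n, hn⟩ := hk.exists_eq_takeWhile ha N₂ κ
    refine ⟨n, fun χ => ?_⟩
    obtain ⟨f₁, hf₁, hlen₁, c, hc⟩ := hn χ
    obtain ⟨f₂, hf₂, hlen₂, d, hd⟩ := hN₂ c
    obtain ⟨col, S, hScol, hScard⟩ : ∃ col, ∃ S : Finset ℕ, (∀ i ∈ S, i < M ∧ d i = col) ∧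
        S.card = m := by
      have := Fintype.ofFinite κ
      obtain ⟨col, -, hcol⟩ := Finset.exists_lt_card_fiber_of_mul_lt_card_of_maps_to
        (s := Finset.range M) (t := Finset.univ) (f := d) (n := m) (by simp)
        (by simpa [← Nat.card_eq_fintype_card] using hM)
      obtain ⟨S, hS, hScard⟩ := Finset.exists_subset_card_eq hcol.le
      exact ⟨col, S, fun i hi => by simpa using hS hi, hScard⟩
    have hcount : Nat.count (· ∈ S) M = m := by
      rw [Nat.count_eq_card_filter_range, ← hScard]
      congr 1
      ext i
      simpa using fun hi => (hScol i hi).1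
    obtain ⟨f₃, hf₃, hlen₃, hJ⟩ := exists_takeWhile_length_mem ha (· ∈ S) M
    rw [hcount] at hf₃ hJ
    refine ⟨f₁.map (letterSubst a (f₂.map (letterSubst a f₃))),
      hf₁.subst (hf₂.subst hf₃ hlen₃) (by simp [hlen₂]), by simp [hlen₁], col,
      fun g hg hgm => ?_⟩
    rw [map_letterSubst_map ha, map_letterSubst_map ha]
    have hw := hf₃.subst hg hgm
    rw [hc _ (hf₂.subst hw (by simp [hlen₃])) (by simp [hlen₂]), hd _ (by simp [hlen₃])]
    refine (hScol _ (hJ g hgm ?_)).2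
    obtain ⟨l₁, l₂, rfl, -⟩ := hg.exists_first le_rfl (by omega)
    exact ⟨a, by simp, le_rfl⟩

/-- A rigid map: every element of the codomain is attained, and before it is first attained only
smaller elements occur. -/
def IsRigid {K L : Type} [LT K] [LT L] (φ : L → K) : Prop :=
  ∀ q, ∃ p, φ p = q ∧ ∀ p' < p, φ p' < q

theorem IsRigid.comp {K L M : Type} [LT K] [LT L] [LT M] {φ : L → K} {h : M → L}
    (hφ : IsRigid φ) (hh : IsRigid h) : IsRigid (φ ∘ h) := fun q =>
  let ⟨_, hp, hpq⟩ := hφ q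
  let ⟨x, hx, hxp⟩ := hh _
  ⟨x, (congrArg φ hx).trans hp, fun j hj => hpq _ (hxp j hj)⟩

theorem ParamWord.isRigid {k n : ℕ} {l : List ℕ} (hl : ParamWord 0 (k + 1) l)
    (hn : l.length = n) : IsRigid fun x : Fin n => Fin.ofNat (k + 1) (l.getD x 0) := by
  intro q
  obtain ⟨l₁, l₂, rfl, hl₁⟩ := hl.exists_first (Nat.zero_le q) (by omega)
  have hlt : l₁.length < n := by simp [← hn]
  refine ⟨⟨l₁.length, hlt⟩, by simp, fun j hj => ?_⟩
  have hj' : (j : ℕ) < l₁.length := hj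
  have hmem := hl₁ _ (List.getElem_mem hj')
  have := q.2
  rw [Fin.lt_def]
  simp only [List.getD_eq_getElem?_getD, List.getElem?_append_left hj',
    List.getElem?_eq_getElem hj', Option.getD_some, Fin.ofNat]
  rwa [Nat.mod_eq_of_lt (hmem.trans this)]

theorem IsRigid.paramWord {k m : ℕ} {φ : Fin m → Fin (k + 1)} (hφ : IsRigid φ) :
    ParamWord 0 (k + 1) (List.ofFn fun i => (φ i : ℕ)) := by
  refine ParamWord.of_exists_first (fun x hx => ?_) fun y _ hy => ?_
  · obtain ⟨i, rfl⟩ := List.mem_ofFn.1 hx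
    have := (φ i).2
    omega
  · obtain ⟨p, hp, hlt⟩ := hφ ⟨y, by omega⟩
    set l := List.ofFn fun i => (φ i : ℕ) with hl
    have hpl : (p : ℕ) < l.length := by simp [hl]
    refine ⟨l.take p, l.drop (p + 1), ?_, fun z hz => ?_⟩
    · have hy : y = l[(p : ℕ)] := by simp [hl, hp]
      rw [hy, List.getElem_cons_drop, List.take_append_drop]
    · obtain ⟨i, hi, rfl⟩ := List.getElem_of_mem hz
      have hip : i < p := by simp at hi; exact hi.1
      simpa [hl, Fin.lt_def] using hlt ⟨i, hip.trans p.2⟩ hip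

/-- The **finite dual Ramsey theorem** for rigid maps. -/
theorem exists_dual_ramsey (K L κ : Type) [LinearOrder K] [LinearOrder L] [Finite K] [Finite L]
    [Nonempty K] [Nonempty L] [Finite κ] :
    ∃ n, ∀ χ : (Fin n → K) → κ, ∃ h : Fin n → L, IsRigid h ∧
      ∃ c, ∀ φ : L → K, IsRigid φ → χ (φ ∘ h) = c := by
  have := Fintype.ofFinite K
  have := Fintype.ofFinite L
  obtain ⟨k, hk⟩ := Nat.exists_eq_succ_of_ne_zero (Fintype.card_ne_zero (α := K))
  obtain ⟨m, hm⟩ := Nat.exists_eq_succ_of_ne_zero (Fintype.card_ne_zero (α := L))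
  let eK := Fintype.orderIsoFinOfCardEq K hk
  let eL := Fintype.orderIsoFinOfCardEq L hm
  obtain ⟨n, hn⟩ := grahamRothschild k 1 one_pos m κ
  refine ⟨n + 1, fun χ => ?_⟩
  obtain ⟨f, hf, hlen, c, hc⟩ :=
    hn fun l => χ fun x => eK (Fin.ofNat (k + 1) ((0 :: l).getD x 0))
  have hf₀ : ParamWord 0 (m + 1) (0 :: f) := .param hf
  refine ⟨fun x => eL (Fin.ofNat (m + 1) ((0 :: f).getD x 0)), fun q => ?_, c, fun φ hφ => ?_⟩
  · obtain ⟨x, hx, hlt⟩ := hf₀.isRigid (n := n + 1) (by simp [hlen]) (eL.symm q)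
    exact ⟨x, by simp only [hx, OrderIso.apply_symm_apply],
      fun j hj => (OrderIso.lt_symm_apply _).1 (hlt j hj)⟩
  · let ψ : Fin (m + 1) → Fin (k + 1) := fun i => eK.symm (φ (eL i))
    have hψ : IsRigid ψ := fun q => by
      obtain ⟨p, hp, hlt⟩ := hφ (eK q)
      refine ⟨eL.symm p, by simp [ψ, hp], fun p' hp' => ?_⟩
      exact (OrderIso.symm_apply_lt _).2 (hlt _ ((OrderIso.lt_symm_apply _).1 hp'))
    have hG := hψ.paramWord
    have hGlen : (List.ofFn fun i => (ψ i : ℕ)).length = m + 1 := by simp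
    have hGget : ∀ i : Fin (m + 1), (List.ofFn fun i => (ψ i : ℕ)).getD i 0 = ψ i := by
      intro i
      rw [List.getD_eq_getElem (hn := by simpa using i.is_le), List.getElem_ofFn]
    generalize (List.ofFn fun i => (ψ i : ℕ)) = G at hG hGlen hGget
    cases hG with
    | letter hx _ => omega
    | @param _ _ g hg =>
      rw [← hc g hg (by simpa using hGlen)]
      congr 1
      funext x
      have hy : (0 :: f).getD x 0 < m + 1 := by
        rw [List.getD_eq_getElem (hn := by simpa [hlen] using x.is_le)]
        simpa using hf₀.lt (List.getElem_mem _)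
      have hmap : (0 :: f.map (letterSubst 1 g)).getD x 0 =
          (0 :: g).getD ((0 :: f).getD x 0) 0 := by
        have h0 : letterSubst 0 (0 :: g) 0 = 0 := letterSubst_cons_self 0 0 g
        rw [← letterSubst_cons_same 0 g]
        have := List.getD_map (l := 0 :: f) (d := 0) (n := (x : ℕ))
          (letterSubst 0 (0 :: g))
        rw [List.map_cons, h0] at this
        rw [this]
        simp [letterSubst]
      have hψy := hGget ⟨_, hy⟩
      simp only at hψy
      rw [hmap, hψy]
      have hof : Fin.ofNat (m + 1) ((0 :: f).getD x 0) = ⟨_, hy⟩ :=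
        Fin.ext (Nat.mod_eq_of_lt hy)
      have hoψ : ∀ i, Fin.ofNat (k + 1) (ψ i : ℕ) = ψ i := fun i =>
        Fin.ext (Nat.mod_eq_of_lt (ψ i).2)
      rw [hoψ, Function.comp_apply, hof]
      exact (eK.apply_symm_apply _).symm

/-- Pairs of `0`-`1`-labellings of `α`, ordered lexicographically. -/
abbrev LabelPair (α : Type) : Type := Lex (α → Bool) ×ₗ Lex (α → Bool)

namespace LabelPair

variable {α : Type}

/-- The pair of labellings with given components. -/
def mk (u d : α → Bool) : LabelPair α := toLex (toLex u, toLex d)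

/-- The first labelling of a pair. -/
def fst (p : LabelPair α) : α → Bool := ofLex (ofLex p).1

/-- The second labelling of a pair. -/
def snd (p : LabelPair α) : α → Bool := ofLex (ofLex p).2

@[simp] theorem fst_mk (u d : α → Bool) : (mk u d).fst = u := rfl

@[simp] theorem snd_mk (u d : α → Bool) : (mk u d).snd = d := rfl

theorem ext {p q : LabelPair α} (h₁ : p.fst = q.fst) (h₂ : p.snd = q.snd) : p = q :=
  Prod.ext (x := ofLex p) (y := ofLex q) h₁ h₂

theorem lt_iff [LinearOrder α] [Finite α] {p q : LabelPair α} :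
    p < q ↔ (∃ i, (∀ j < i, p.fst j = q.fst j) ∧ p.fst i = false ∧ q.fst i = true) ∨
      p.fst = q.fst ∧ ∃ i, (∀ j < i, p.snd j = q.snd j) ∧ p.snd i = false ∧ q.snd i = true := by
  have key : ∀ u v : Lex (α → Bool), u < v ↔
      ∃ i, (∀ j < i, ofLex u j = ofLex v j) ∧ ofLex u i = false ∧ ofLex v i = true :=
    fun u v => exists_congr fun i => and_congr Iff.rfl Bool.lt_iff
  rw [Prod.Lex.lt_iff, key, key]
  exact Iff.rfl

/-- The strict order on pairs given by pointwise comparison of the first labellings. -/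
def prec (p q : LabelPair α) : Prop := p.fst < q.fst

/-- The second labelling of `p` is `true` at the place where the first labellings of `p` and `q`
first differ. -/
def marks [LinearOrder α] (p q : LabelPair α) : Prop :=
  ∃ i, (∀ j < i, p.fst j = q.fst j) ∧ p.fst i ≠ q.fst i ∧ p.snd i = true

/-- The tournament on pairs obtained from the linear order by reversing the pairs which are not
marked. -/
def beats [LinearOrder α] [Finite α] (p q : LabelPair α) : Prop :=
  p < q ∧ p.marks q ∨ q < p ∧ ¬ q.marks p

theorem marks_iff [LinearOrder α] {p q : LabelPair α} {i : α}
    (h : ∀ j < i, p.fst j = q.fst j) (hi : p.fst i ≠ q.fst i) :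
    p.marks q ↔ p.snd i = true := by
  refine ⟨fun ⟨x, hx, hxne, hs⟩ => ?_, fun hs => ⟨i, h, hi, hs⟩⟩
  rcases lt_trichotomy x i with hlt | rfl | hlt
  · exact absurd (h x hlt) hxne
  · exact hs
  · exact absurd (hx i hlt) hi

end LabelPair

/-- `P` is a strict partial order extended by the given linear order, and `T` is a tournament. -/
structure IsPosetTournament {α : Type} [LinearOrder α] (P T : α → α → Prop) : Prop where
  irrefl : ∀ x, ¬ P x x
  trans : ∀ x y z, P x y → P y z → P x z
  lt : ∀ x y, P x y → x < y
  tournament_irrefl : ∀ x, ¬ T x x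
  tournament : ∀ x y, x ≠ y → (T x y ↔ ¬ T y x)

theorem LabelPair.isPosetTournament (α : Type) [LinearOrder α] [Finite α] :
    IsPosetTournament (α := LabelPair α) LabelPair.prec LabelPair.beats where
  irrefl _ := lt_irrefl _
  trans _ _ _ := lt_trans
  lt x y h := Prod.Lex.lt_iff.2 <| .inl <| Pi.toLex_strictMono h
  tournament_irrefl x h := by
    rcases h with h | h <;> exact lt_irrefl _ h.1
  tournament x y h := by
    rcases lt_or_gt_of_ne h with h | h <;> simp [beats, h, h.not_gt]

/-- The pairs of labellings whose first component is the indicator of an upper set of `P`. -/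
abbrev UpperLabel {α : Type} (P : α → α → Prop) : Type :=
  {p : LabelPair α // ∀ a b, P a b → p.fst a = true → p.fst b = true}

open Classical in
/-- The indicator of the set of vertices beating the least element of the set indicated by `u`. -/
noncomputable def beatsLeast {α : Type} [LinearOrder α] (T : α → α → Prop) (u : α → Bool)
    (c : α) : Bool :=
  decide (∃ m, IsLeast {a | u a = true} m ∧ T c m)

/-- The second labelling of `p`, read relative to `beatsLeast`. -/
noncomputable def twist {α : Type} [LinearOrder α] (T : α → α → Prop) (p : LabelPair α)
    (c : α) : Bool :=
  xor (p.snd c) (beatsLeast T p.fst c)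

/-- A sequence of labels assigns to each vertex a pair of labellings of the index set. -/
noncomputable def encode {α ι : Type} [LinearOrder α] {P : α → α → Prop} (T : α → α → Prop)
    (h : ι → UpperLabel P) (a : α) : LabelPair ι :=
  .mk (fun x => (h x).1.fst a) fun x => twist T (h x).1 a

section Encode

variable {α β ι : Type} [LinearOrder α] [LinearOrder β]
  {P T : α → α → Prop} {Q S : β → β → Prop}

/-- Restriction of labels along an embedding. -/
noncomputable def restrict (T : α → α → Prop) (S : β → β → Prop) (e : α → β)
    (he : ∀ a b, P a b ↔ Q (e a) (e b)) (p : UpperLabel Q) : UpperLabel P :=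
  ⟨.mk (p.1.fst ∘ e) fun c => xor (twist S p.1 (e c)) (beatsLeast T (p.1.fst ∘ e) c),
    fun a b hab => p.2 _ _ ((he a b).1 hab)⟩

theorem encode_restrict (e : α → β) (he : ∀ a b, P a b ↔ Q (e a) (e b)) (h : ι → UpperLabel Q) :
    encode T (restrict T S e he ∘ h) = encode S h ∘ e := by
  funext a
  refine LabelPair.ext rfl ?_
  funext x
  simp [encode, restrict, twist]

open Classical in
/-- The label given by the principal upper set of `b`. -/
noncomputable def principal (hP : IsPosetTournament P T) (b : α) : UpperLabel P :=
  ⟨.mk (fun c => decide (c = b ∨ P b c)) fun _ => false, fun a c hac ha => by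
    simp only [LabelPair.fst_mk, decide_eq_true_eq] at ha ⊢
    rcases ha with rfl | ha
    · exact .inr hac
    · exact .inr (hP.trans _ _ _ ha hac)⟩

theorem principal_fst (hP : IsPosetTournament P T) (b c : α) :
    (principal hP b).1.fst c = true ↔ c = b ∨ P b c := by
  simp [principal]

theorem twist_principal (hP : IsPosetTournament P T) (a b : α) :
    twist T (principal hP b).1 a = true ↔ T a b := by
  have hleast : IsLeast {c | (principal hP b).1.fst c = true} b := by
    refine ⟨(principal_fst hP b b).2 (.inl rfl), fun c hc => ?_⟩
    rcases (principal_fst hP b c).1 hc with rfl | h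
    · exact le_rfl
    · exact (hP.lt _ _ h).le
  rw [twist, show (principal hP b).1.snd a = false from rfl, Bool.false_xor, beatsLeast]
  simp only [decide_eq_true_eq]
  exact ⟨fun ⟨m, hm, h⟩ => hleast.unique hm ▸ h, fun h => ⟨b, hleast, h⟩⟩

variable [Finite α]

/-- A label smaller than the principal one of `b` does not separate `b` from smaller elements. -/
theorem fst_eq_of_lt_principal (hP : IsPosetTournament P T) {a b : α} (hab : a < b)
    {p : UpperLabel P} (hp : p < principal hP b) : p.1.fst a = p.1.fst b := by
  rcases LabelPair.lt_iff.1 (show p.1 < (principal hP b).1 from hp) with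
    ⟨i, hi, hpi, hbi⟩ | ⟨-, i, -, -, hi⟩
  · have hbi' := (principal_fst hP b i).1 hbi
    have hle : b ≤ i := by
      rcases hbi' with rfl | h
      · exact le_rfl
      · exact (hP.lt _ _ h).le
    have ha : p.1.fst a = false := by
      rw [hi a (hab.trans_le hle), ← Bool.not_eq_true, principal_fst]
      rintro (rfl | h)
      · exact lt_irrefl _ hab
      · exact lt_asymm hab (hP.lt _ _ h)
    rw [ha, eq_comm, ← Bool.not_eq_true]
    intro hb
    rcases hbi' with rfl | h
    · simp [hpi] at hb
    · simp [p.2 _ _ h hb] at hpi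
  · simp [principal] at hi

variable [LinearOrder ι]

theorem exists_first_difference (hP : IsPosetTournament P T) {h : ι → UpperLabel P}
    (hh : IsRigid h) {a b : α} (hab : a < b) :
    ∃ x, (∀ j < x, (encode T h a).fst j = (encode T h b).fst j) ∧
      (encode T h a).fst x = false ∧ (encode T h b).fst x = true ∧
      ((encode T h a).snd x = true ↔ T a b) := by
  obtain ⟨x, hx, hlt⟩ := hh (principal hP b)
  refine ⟨x, fun j hj => fst_eq_of_lt_principal hP hab (hlt j hj), ?_, ?_, ?_⟩
  · simp only [encode, LabelPair.fst_mk, hx]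
    rw [← Bool.not_eq_true, principal_fst]
    rintro (rfl | h)
    · exact lt_irrefl _ hab
    · exact lt_asymm hab (hP.lt _ _ h)
  · simp only [encode, LabelPair.fst_mk, hx]
    exact (principal_fst hP b b).2 (.inl rfl)
  · simp only [encode, LabelPair.snd_mk, hx]
    exact twist_principal hP a b

theorem encode_prec_iff (hP : IsPosetTournament P T) {h : ι → UpperLabel P}
    (hh : IsRigid h) (a b : α) : P a b ↔ (encode T h a).prec (encode T h b) := by
  constructor
  · intro hab
    refine lt_of_le_of_ne (fun x hx => (h x).2 a b hab hx) fun he => ?_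
    obtain ⟨x, -, ha, hb, -⟩ := exists_first_difference hP hh (hP.lt _ _ hab)
    rw [he, hb] at ha
    exact Bool.noConfusion ha
  · intro hab
    obtain ⟨x, hx, -⟩ := hh (principal hP a)
    have ha : (encode T h a).fst x = true := by
      simp only [encode, LabelPair.fst_mk, hx]
      exact (principal_fst hP a a).2 (.inl rfl)
    have hb : (encode T h b).fst x = true := hab.le x ha
    simp only [encode, LabelPair.fst_mk, hx] at hb
    rcases (principal_fst hP a b).1 hb with rfl | h
    · exact absurd hab (lt_irrefl _)
    · exact h

variable [Finite ι]

theorem encode_lt_of_lt (hP : IsPosetTournament P T) {h : ι → UpperLabel P}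
    (hh : IsRigid h) {a b : α} (hab : a < b) : encode T h a < encode T h b :=
  let ⟨x, hx, ha, hb, _⟩ := exists_first_difference hP hh hab
  LabelPair.lt_iff.2 (.inl ⟨x, hx, ha, hb⟩)

theorem encode_strictMono (hP : IsPosetTournament P T) {h : ι → UpperLabel P}
    (hh : IsRigid h) : StrictMono (encode T h) := fun _ _ => encode_lt_of_lt hP hh

theorem encode_beats_iff (hP : IsPosetTournament P T) {h : ι → UpperLabel P}
    (hh : IsRigid h) (a b : α) : T a b ↔ (encode T h a).beats (encode T h b) := by
  have key : ∀ a b : α, a < b → (T a b ↔ (encode T h a).beats (encode T h b)) := by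
    intro a b hab
    obtain ⟨x, hx, ha, hb, hT⟩ := exists_first_difference hP hh hab
    have hlt := encode_lt_of_lt hP hh hab
    rw [← hT, ← LabelPair.marks_iff hx (by simp [ha, hb])]
    simp [LabelPair.beats, hlt, hlt.not_gt]
  rcases lt_trichotomy a b with hab | rfl | hab
  · exact key a b hab
  · exact iff_of_false (hP.tournament_irrefl a)
      ((LabelPair.isPosetTournament ι).tournament_irrefl _)
  · rw [hP.tournament a b hab.ne', key b a hab,
      (LabelPair.isPosetTournament ι).tournament _ _ (encode_lt_of_lt hP hh hab).ne, not_not]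

open Classical in
theorem isRigid_restrict [Finite β] (hQ : IsPosetTournament Q S) {e : α → β}
    (he : ∀ a b, P a b ↔ Q (e a) (e b)) (hlt : StrictMono e) (hS : ∀ a b, T a b ↔ S (e a) (e b)) :
    IsRigid (restrict T S e he) := by
  intro q
  set u : β → Bool := fun b => decide (∃ v, q.1.fst v = true ∧ (b = e v ∨ Q (e v) b)) with hu
  set d : β → Bool := fun b => decide (∃ v, q.1.snd v = true ∧ b = e v) with hd
  have hue : u ∘ e = q.1.fst := by
    funext a
    rw [Bool.eq_iff_iff]
    simp only [hu, Function.comp, decide_eq_true_eq]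
    constructor
    · rintro ⟨v, hv, h | h⟩
      · rwa [hlt.injective h]
      · exact q.2 _ _ ((he _ _).2 h) hv
    · exact fun h => ⟨a, h, .inl rfl⟩
  have hde : d ∘ e = q.1.snd := by
    funext a
    rw [Bool.eq_iff_iff]
    simp only [hd, Function.comp, decide_eq_true_eq]
    constructor
    · rintro ⟨v, hv, h⟩
      rwa [hlt.injective h]
    · exact fun h => ⟨a, h, rfl⟩
  have hleast : ∀ m, IsLeast {a | q.1.fst a = true} m → IsLeast {b | u b = true} (e m) := by
    refine fun m hm => ⟨(congrFun hue m).trans hm.1, fun b hb => ?_⟩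
    obtain ⟨v, hv, h⟩ := of_decide_eq_true hb
    have hmv : e m ≤ e v := hlt.monotone (hm.2 hv)
    rcases h with rfl | h
    · exact hmv
    · exact hmv.trans (hQ.lt _ _ h).le
  have hbeats : beatsLeast S u ∘ e = beatsLeast T q.1.fst := by
    funext c
    rw [Bool.eq_iff_iff]
    simp only [beatsLeast, Function.comp, decide_eq_true_eq]
    constructor
    · rintro ⟨b, hb, hcb⟩
      obtain ⟨v, hv, -⟩ := of_decide_eq_true hb.1
      obtain ⟨m, hm⟩ := (Set.toFinite {a | q.1.fst a = true}).exists_minimal ⟨v, hv⟩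
      have hm' : IsLeast {a | q.1.fst a = true} m :=
        ⟨hm.prop, fun a ha => le_of_not_gt fun h => hm.not_lt ha h⟩
      refine ⟨m, hm', (hS _ _).2 ?_⟩
      rwa [← hb.unique (hleast m hm')]
    · rintro ⟨m, hm, hcm⟩
      exact ⟨e m, hleast m hm, (hS _ _).1 hcm⟩
  have hup : ∀ a b, Q a b → u a = true → u b = true := by
    intro a b hab ha
    obtain ⟨v, hv, h⟩ := of_decide_eq_true ha
    refine decide_eq_true ⟨v, hv, .inr ?_⟩
    rcases h with rfl | h
    · exact hab
    · exact hQ.trans _ _ _ h hab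
  have hsnd : ∀ p : UpperLabel Q, p.1.fst = u → (restrict T S e he p).1.snd = p.1.snd ∘ e := by
    intro p hp
    funext c
    have := congrFun hbeats c
    simp only [Function.comp] at this
    simp [restrict, twist, hp, hue, this]
  refine ⟨⟨.mk u d, hup⟩, Subtype.ext (LabelPair.ext hue ?_), fun p hp => ?_⟩
  · rw [hsnd _ rfl]
    exact hde
  · refine LabelPair.lt_iff.2 ?_
    rcases LabelPair.lt_iff.1 (show p.1 < .mk u d from hp) with
      ⟨i, hi, hpi, hui⟩ | ⟨hpu, i, hi, hpi, hdi⟩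
    · left
      obtain ⟨v, hv, h⟩ := of_decide_eq_true hui
      have huv : u (e v) = true := (congrFun hue v).trans hv
      obtain rfl : i = e v := by
        refine h.resolve_right fun h => ?_
        have : p.1.fst (e v) = true := (hi _ (hQ.lt _ _ h)).trans huv
        rw [p.2 _ _ h this] at hpi
        exact Bool.noConfusion hpi
      exact ⟨v, fun j hj => (hi _ (hlt hj)).trans (congrFun hue j), hpi, hv⟩
    · right
      obtain ⟨v, hv, rfl⟩ := of_decide_eq_true hdi
      refine ⟨?_, ?_⟩
      · rw [← hue, ← (show p.1.fst = u from hpu)]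
        rfl
      · rw [hsnd p hpu]
        exact ⟨v, fun j hj => (hi _ (hlt hj)).trans (congrFun hde j), hpi, hv⟩

end Encode

instance {α : Type} (P : α → α → Prop) : Nonempty (UpperLabel P) :=
  ⟨.mk (fun _ => false) fun _ => false, by simp⟩

instance {α : Type} [Finite α] : Finite (LabelPair α) :=
  inferInstanceAs (Finite ((α → Bool) × (α → Bool)))

/-- The poset with linear extension and tournament on the pairs of labellings of `Fin n`. -/
def labelStr (n : ℕ) : BinStr (Fin 3) where
  carrier := LabelPair (Fin n)
  rel := ![LabelPair.prec, (· < ·), LabelPair.beats]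

/-- The embedding into `labelStr n` given by a rigid sequence of labels. -/
noncomputable def encodeEmb {n : ℕ} (A : BinStr (Fin 3)) [LinearOrder A.carrier]
    [Finite A.carrier] (hA : IsPosetTournament (A.rel 0) (A.rel 2))
    (hlt : ∀ x y, A.rel 1 x y ↔ x < y) (h : Fin n → UpperLabel (A.rel 0)) (hh : IsRigid h) :
    BinEmb A (labelStr n) where
  toFun := encode (A.rel 2) h
  inj := (encode_strictMono hA hh).injective
  map_rel i x y := by
    fin_cases i
    · exact encode_prec_iff hA hh x y
    · exact (hlt x y).trans (encode_strictMono hA hh).lt_iff_lt.symm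
    · exact encode_beats_iff hA hh x y

theorem BinEmb.ext_toFun {ι : Type} {A B : BinStr ι} {f g : BinEmb A B}
    (h : f.toFun = g.toFun) : f = g := by
  cases f
  cases g
  congr

theorem exists_labelStr_ramsey (A B : BinStr (Fin 3)) [LinearOrder A.carrier]
    [LinearOrder B.carrier] [Finite A.carrier] [Finite B.carrier]
    (hA : IsPosetTournament (A.rel 0) (A.rel 2)) (hB : IsPosetTournament (B.rel 0) (B.rel 2))
    (hltA : ∀ x y, A.rel 1 x y ↔ x < y) (hltB : ∀ x y, B.rel 1 x y ↔ x < y) (r : ℕ) :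
    ∃ n, ∀ χ : BinEmb A (labelStr n) → Fin r, ∃ g : BinEmb B (labelStr n),
      ∀ f₁ f₂ : BinEmb A B, χ (g.comp f₁) = χ (g.comp f₂) := by
  classical
  obtain ⟨n, hn⟩ := exists_dual_ramsey (UpperLabel (A.rel 0)) (UpperLabel (B.rel 0))
    (Option (Fin r))
  refine ⟨n, fun χ => ?_⟩
  obtain ⟨h, hh, c, hc⟩ := hn fun h =>
    if hh : IsRigid h then some (χ (encodeEmb A hA hltA h hh)) else none
  refine ⟨encodeEmb B hB hltB h hh, ?_⟩
  have key : ∀ f : BinEmb A B, some (χ ((encodeEmb B hB hltB h hh).comp f)) = c := by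
    intro f
    have hmono : StrictMono f.toFun := fun x y hxy =>
      (hltB _ _).1 ((f.map_rel 1 x y).1 ((hltA x y).2 hxy))
    have hφ := isRigid_restrict hB (f.map_rel 0) hmono (f.map_rel 2)
    rw [← hc _ hφ, dif_pos (hφ.comp hh)]
    congr 2
    exact BinEmb.ext_toFun (encode_restrict _ _ h).symm
  exact fun f₁ f₂ => Option.some_injective _ ((key f₁).trans (key f₂).symm)

/-- The class of all finite structures `(X, ≺, <, T)`, where `≺` (index 0) is a strict partial
order, `<` (index 1) is a strict linear order extending `≺`, and `T` (index 2) is a tournament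
relation (never `T x x`, and for distinct `x, y` exactly one of `T x y`, `T y x` holds), has
the Ramsey property. -/
theorem statement19 :
    BinRamseyClass {A : BinStr (Fin 3) |
      Finite A.carrier ∧
        IsStrictOrder A.carrier (A.rel 0) ∧
        IsStrictTotalOrder A.carrier (A.rel 1) ∧
        (∀ x y : A.carrier, A.rel 0 x y → A.rel 1 x y) ∧
        (∀ x : A.carrier, ¬ A.rel 2 x x) ∧
        (∀ x y : A.carrier, x ≠ y → (A.rel 2 x y ↔ ¬ A.rel 2 y x))} := by

  rintro A ⟨hAfin, hA₀, hA₁, hA₀₁, hA₂, hA₂'⟩ B ⟨hBfin, hB₀, hB₁, hB₀₁, hB₂, hB₂'⟩ r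
  classical
  let : LinearOrder A.carrier := linearOrderOfSTO (A.rel 1)
  let : LinearOrder B.carrier := linearOrderOfSTO (B.rel 1)
  have hA : IsPosetTournament (A.rel 0) (A.rel 2) :=
    ⟨hA₀.irrefl, hA₀.trans, hA₀₁, hA₂, hA₂'⟩
  have hB : IsPosetTournament (B.rel 0) (B.rel 2) :=
    ⟨hB₀.irrefl, hB₀.trans, hB₀₁, hB₂, hB₂'⟩
  obtain ⟨n, hn⟩ := exists_labelStr_ramsey A B hA hB (fun _ _ => Iff.rfl) (fun _ _ => Iff.rfl) r
  have hC := LabelPair.isPosetTournament (Fin n)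
  refine ⟨labelStr n, ⟨inferInstanceAs (Finite (LabelPair (Fin n))), ?_, ?_, hC.lt,
    hC.tournament_irrefl, hC.tournament⟩, hn⟩
  · exact { irrefl := hC.irrefl, trans := hC.trans }
  · exact inferInstanceAs (IsStrictTotalOrder (LabelPair (Fin n)) (· < ·))
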